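/- arXiv:1010.0152 — 2 statements merged into one kernel-verified Lean document; each statement's English description precedes it below -/
import Mathlib

section
/- Let k be a finite field with q elements of characteristic 3 and let m ≥ 1 be an integer. Then the set S of tuples (a₂, α₂, a₄, α₄, a₆, α₆) ∈ (k × k^m)³ for which there exist x, y ∈ k with y² = x³ + a₂·x² + a₄·x + a₆, 2y = 0, 3x² + 2a₂·x + a₄ = 0, and α₂_j·x² + α₄_j·x + α₆_j = 0 for all j = 1,…,m, has exactly q^{2(m+1)} elements. Consequently the proportion of such 'singular jets' among all q^{3(m+1)} tuples is q^{-(m+1)}. -/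
noncomputable section

/-- The set of 'singular jets' `(a₂, α₂, a₄, α₄, a₆, α₆)` in characteristic 3:
the Weierstrass hypersurface `y² = x³ + a₂x² + a₄x + a₆` is singular at a point
`(x,y)` in the fiber over a base point where each coefficient `a_i` has value `aᵢ`
and first-order partial derivatives `αᵢ`. -/
def SingJets3 (k : Type) [Field k] (m : ℕ) :
    Set ((k × (Fin m → k)) × (k × (Fin m → k)) × (k × (Fin m → k))) :=
  {t | ∃ x y : k,
    y ^ 2 = x ^ 3 + t.1.1 * x ^ 2 + t.2.1.1 * x + t.2.2.1 ∧
    2 * y = 0 ∧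
    3 * x ^ 2 + 2 * t.1.1 * x + t.2.1.1 = 0 ∧
    ∀ j, t.1.2 j * x ^ 2 + t.2.1.2 j * x + t.2.2.2 j = 0}

/-- The jet with leading coefficient `a₂` and free derivatives `α₂`, `α₄` that is singular at the
point `(x, 0)`, as a function of `((x, a₂), (α₂, α₄))`. -/
def singJet {k : Type} [Field k] {m : ℕ} (p : (k × k) × ((Fin m → k) × (Fin m → k))) :
    (k × (Fin m → k)) × (k × (Fin m → k)) × (k × (Fin m → k)) :=
  ((p.1.2, p.2.1), (p.1.2 * p.1.1, p.2.2),
    (-p.1.1 ^ 3 + p.1.2 * p.1.1 ^ 2, fun j => -(p.2.1 j * p.1.1 ^ 2 + p.2.2 j * p.1.1)))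

theorem singJet_injective {k : Type} [Field k] [CharP k 3] {m : ℕ} :
    Function.Injective (singJet (k := k) (m := m)) := by
  rintro ⟨⟨x, a⟩, α, β⟩ ⟨⟨x', a'⟩, α', β'⟩ h
  simp only [singJet, Prod.mk.injEq] at h
  obtain ⟨⟨rfl, rfl⟩, ⟨h4, rfl⟩, h6, -⟩ := h
  suffices x = x' by rw [this]
  rcases mul_eq_mul_left_iff.mp h4 with h | rfl
  · exact h
  · have : Fact (Nat.Prime 3) := ⟨Nat.prime_three⟩
    exact frobenius_inj k 3 (by simpa [frobenius_def] using h6)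

theorem range_singJet (k : Type) [Field k] [CharP k 3] (m : ℕ) :
    Set.range (singJet (k := k) (m := m)) = SingJets3 k m := by
  have h3 : (3 : k) = 0 := by exact_mod_cast CharP.cast_eq_zero k 3
  ext ⟨⟨a, α⟩, ⟨b, β⟩, ⟨c, γ⟩⟩
  constructor
  · rintro ⟨⟨⟨x, a'⟩, α', β'⟩, h⟩
    simp only [singJet, Prod.mk.injEq] at h
    obtain ⟨⟨rfl, rfl⟩, ⟨rfl, rfl⟩, rfl, rfl⟩ := h
    refine ⟨x, 0, ?_, by simp, ?_, fun j => ?_⟩ <;> dsimp only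
    · linear_combination (-a' * x ^ 2) * h3
    · linear_combination (x ^ 2 + a' * x) * h3
    · ring
  · rintro ⟨x, y, h1, h2, h4, h6⟩
    dsimp only at h1 h2 h4 h6
    have hy : y = 0 := by linear_combination y * h3 - h2
    subst hy
    have hb : a * x = b := by linear_combination (x ^ 2 + a * x) * h3 - h4
    refine ⟨((x, a), (α, β)), ?_⟩
    subst hb
    simp only [singJet, Prod.mk.injEq, true_and]
    refine ⟨by linear_combination h1 + a * x ^ 2 * h3, funext fun j => ?_⟩
    linear_combination -h6 j

theorem natCard_singJets3 (k : Type) [Field k] [Fintype k] [CharP k 3] (m : ℕ) :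
    Nat.card (SingJets3 k m) = Fintype.card k ^ (2 * (m + 1)) := by
  rw [← range_singJet, Nat.card_range_of_injective singJet_injective]
  simp only [Nat.card_prod, Nat.card_fun, Nat.card_fin, Nat.card_eq_fintype_card (α := k)]
  ring

/-- over a finite field of characteristic `3` with `q` elements,
the set of singular jets has exactly `q^(2(m+1))` elements; consequently its
proportion among all `q^(3(m+1))` jets is `q^(-(m+1))`. -/
theorem stmt7 (k : Type) [Field k] [Fintype k] [CharP k 3] (m : ℕ) (hm : 1 ≤ m) :
    Nat.card (SingJets3 k m) = Fintype.card k ^ (2 * (m + 1)) ∧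
    (Nat.card (SingJets3 k m) : ℝ) / (Fintype.card k : ℝ) ^ (3 * (m + 1)) =
      ((Fintype.card k : ℝ) ^ (m + 1))⁻¹ := by
  have hcard := natCard_singJets3 k m
  refine ⟨hcard, ?_⟩
  have hq : (Fintype.card k : ℝ) ≠ 0 := by exact_mod_cast Fintype.card_ne_zero
  rw [hcard]
  push_cast
  field_simp
  ring
end
end

section
/- Let q be a power of a prime p > 3 and let m ≥ 3. Then the limit as k → ∞ of the fraction of Weierstrass pairs (A,B) of level k such that the set {P ∈ ℙ^m(𝔽̄_q) : W_{A,B} is singular over P} is finite (i.e. the Weierstrass model is smooth in codimension 3) exists and equals 1. -/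
open MvPolynomial Filter

noncomputable section

variable (F : Type) [Field F] [Fintype F]

/-- The set of Weierstrass pairs `(A,B)` of level `k`: `A` homogeneous of degree `4k`
and `B` homogeneous of degree `6k`. -/
def WPairs (m k : ℕ) : Set (MvPolynomial (Fin (m + 1)) F × MvPolynomial (Fin (m + 1)) F) :=
  {AB | AB.1.IsHomogeneous (4 * k) ∧ AB.2.IsHomogeneous (6 * k)}

/-- The Weierstrass model `W_{A,B}` is singular at a point lying over the point of
`ℙ^m(𝔽̄_q)` with homogeneous coordinates `pt`. -/
def SingAt (m : ℕ) (A B : MvPolynomial (Fin (m + 1)) F)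
    (pt : Fin (m + 1) → AlgebraicClosure F) : Prop :=
  ∃ x y : AlgebraicClosure F,
    y ^ 2 = x ^ 3 + aeval pt A * x + aeval pt B ∧
    2 * y = 0 ∧
    3 * x ^ 2 + aeval pt A = 0 ∧
    ∀ i, aeval pt (pderiv i A) * x + aeval pt (pderiv i B) = 0

/-- `W_{A,B}` is singular over a point `P ∈ ℙ^m(𝔽̄_q)`. -/
def SingOver (m : ℕ) (A B : MvPolynomial (Fin (m + 1)) F)
    (P : Projectivization (AlgebraicClosure F) (Fin (m + 1) → AlgebraicClosure F)) : Prop :=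
  ∃ (pt : Fin (m + 1) → AlgebraicClosure F) (hpt : pt ≠ 0),
    Projectivization.mk (AlgebraicClosure F) pt hpt = P ∧ SingAt F m A B pt

set_option linter.unusedSectionVars false

/-- `n` polynomials in `n` variables of degree at most `d`, together with one of the variables,
satisfy a relation of controlled degree. -/
theorem exists_relation_of_degreeOf_le {K : Type} [Field K] {n d : ℕ} (hn : 1 ≤ n) (hd : 1 ≤ d)
    (E : Fin n → MvPolynomial (Fin n) K) (hE : ∀ l i, (E l).degreeOf i ≤ d) (j : Fin n) :
    ∃ Ψ : MvPolynomial (Fin n) (Polynomial K), Ψ ≠ 0 ∧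
      (∀ i, Ψ.degreeOf i ≤ (2 * n * d) ^ n) ∧
      eval₂ (Polynomial.aeval (X j : MvPolynomial (Fin n) K)).toRingHom E Ψ = 0 := by
  classical
  set D := (2 * n * d) ^ n with hD
  set T := n * D * d with hT
  let I := Fin (T + 1) × (Fin n → Fin (D + 1))
  let v : I → MvPolynomial (Fin n) K := fun a => X j ^ (a.1 : ℕ) * ∏ l, E l ^ (a.2 l : ℕ)
  have hv : ∀ a i, (v a).degreeOf i ≤ 2 * T := by
    intro a i
    refine (degreeOf_mul_le _ _ _).trans ?_
    have h1 : degreeOf i (X j ^ (a.1 : ℕ) : MvPolynomial (Fin n) K) ≤ T := by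
      refine (degreeOf_pow_le _ _ _).trans ?_
      have : degreeOf i (X j : MvPolynomial (Fin n) K) ≤ 1 := by
        rw [degreeOf_X]; split_ifs <;> simp
      have h3 := a.1.2
      nlinarith
    have h2 : degreeOf i (∏ l, E l ^ (a.2 l : ℕ)) ≤ T := by
      refine (degreeOf_prod_le _ _ _).trans ?_
      calc ∑ l, degreeOf i (E l ^ (a.2 l : ℕ)) ≤ ∑ l : Fin n, D * d := by
            refine Finset.sum_le_sum fun l _ => (degreeOf_pow_le _ _ _).trans ?_
            exact Nat.mul_le_mul (Nat.lt_succ_iff.mp (a.2 l).2) (hE l i)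
        _ = T := by simp [hT, mul_assoc]
    omega
  let box : (Fin n → Fin (2 * T + 1)) → (Fin n →₀ ℕ) := fun b =>
    Finsupp.equivFunOnFinite.symm fun i => (b i : ℕ)
  let Λ : (I → K) →ₗ[K] ((Fin n → Fin (2 * T + 1)) → K) :=
    LinearMap.pi fun b => (lcoeff K (box b)).comp (Fintype.linearCombination K v)
  have hrank : Module.finrank K ((Fin n → Fin (2 * T + 1)) → K) < Module.finrank K (I → K) := by
    simp only [Module.finrank_fintype_fun_eq_card, I, Fintype.card_prod, Fintype.card_fun,
      Fintype.card_fin]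
    have h1 : 2 * T + 1 ≤ (2 * n * d) * (D + 1) := by
      have : 1 ≤ n * d := Nat.mul_pos hn hd
      rw [hT]; nlinarith
    have h2 : D ≤ T := by
      have : 1 ≤ n * d := Nat.mul_pos hn hd
      rw [hT]; nlinarith
    calc (2 * T + 1) ^ n ≤ ((2 * n * d) * (D + 1)) ^ n := Nat.pow_le_pow_left h1 n
      _ = D * (D + 1) ^ n := by rw [mul_pow]
      _ < (T + 1) * (D + 1) ^ n := by
        apply Nat.mul_lt_mul_of_pos_right (by omega) (by positivity)
  obtain ⟨c, hc, hc0⟩ := Submodule.exists_mem_ne_zero_of_ne_bot (Λ.ker_ne_bot_of_finrank_lt hrank)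
  have hsum : ∑ a, c a • v a = 0 := by
    ext b
    rw [coeff_zero]
    by_cases hb : ∀ i, b i < 2 * T + 1
    · have := congrFun (LinearMap.mem_ker.mp hc) fun i => ⟨b i, hb i⟩
      have hbb : box (fun i => ⟨b i, hb i⟩) = b := by ext; simp [box]
      simpa [Λ, hbb, Fintype.linearCombination_apply, coeff_sum] using this
    · push Not at hb
      obtain ⟨i, hi⟩ := hb
      rw [coeff_sum]
      refine Finset.sum_eq_zero fun a _ => ?_
      rw [coeff_smul, notMem_support_iff.mp (notMem_support_of_degreeOf_lt i
        (lt_of_le_of_lt (hv a i) hi)), smul_zero]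
  let exp : (Fin n → Fin (D + 1)) → (Fin n →₀ ℕ) := fun s =>
    Finsupp.equivFunOnFinite.symm fun i => (s i : ℕ)
  have hexp : Function.Injective exp := by
    intro s s' h
    ext i
    simpa [exp] using DFunLike.congr_fun h i
  refine ⟨∑ a : I, monomial (exp a.2) (Polynomial.monomial (a.1 : ℕ) (c a)), ?_, ?_, ?_⟩
  · intro h0
    apply hc0
    funext a
    have h1 := congrArg (fun P => (coeff (exp a.2) P).coeff (a.1 : ℕ)) h0
    simp only [coeff_sum, coeff_monomial, Polynomial.finsetSum_coeff, coeff_zero,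
      Polynomial.coeff_zero] at h1
    rw [Finset.sum_eq_single a] at h1
    · simpa using h1
    · intro b _ hba
      by_cases h2 : exp b.2 = exp a.2
      · rw [if_pos h2, Polynomial.coeff_monomial, if_neg]
        intro h3
        exact hba (Prod.ext (Fin.ext h3) (hexp h2))
      · rw [if_neg h2, Polynomial.coeff_zero]
    · simp
  · intro i
    refine (degreeOf_sum_le _ _ _).trans (Finset.sup_le fun a _ => ?_)
    by_cases h0 : Polynomial.monomial (a.1 : ℕ) (c a) = 0
    · simp [h0]
    · rw [degreeOf_monomial_eq _ _ h0]
      exact Nat.lt_succ_iff.mp (a.2 i).2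
  · rw [eval₂_sum, ← hsum]
    refine Finset.sum_congr rfl fun a _ => ?_
    rw [eval₂_monomial, Finsupp.prod_fintype _ _ (by simp)]
    simp [v, exp, Polynomial.aeval_monomial, smul_eq_C_mul, mul_assoc, algebraMap_eq]

/-- The total degree does not grow under substitution of polynomials of degree at most one. -/
theorem totalDegree_aeval_le_of_totalDegree_le_one {K σ τ : Type} [Field K]
    (g : σ → MvPolynomial τ K) (hg : ∀ i, (g i).totalDegree ≤ 1) (f : MvPolynomial σ K) :
    (aeval g f).totalDegree ≤ f.totalDegree := by
  rw [aeval_def, eval₂_eq]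
  refine totalDegree_finsetSum_le fun s hs => (totalDegree_mul _ _).trans ?_
  rw [algebraMap_eq, totalDegree_C, zero_add]
  refine (totalDegree_finsetProd _ _).trans ((Finset.sum_le_sum fun i _ => ?_).trans
    (le_totalDegree hs))
  exact (totalDegree_pow _ _).trans (by nlinarith [hg i])

/-- If translates of every point of a finite set `G` by a random vector are rarely bad, then
the bad points of `G` are rare. -/
theorem card_filter_le_of_translates {M U : Type} [AddCommGroup M] [Fintype U] [Nonempty U]
    (G : Finset M)
    (t : U → M) (hG : ∀ g u, g ∈ G ↔ g + t u ∈ G) (bad : M → Prop) [DecidablePred bad] (ε : ℝ)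
    (h : ∀ g ∈ G, ((Finset.univ.filter fun u => bad (g + t u)).card : ℝ) ≤ ε * Fintype.card U) :
    ((G.filter bad).card : ℝ) ≤ ε * G.card := by
  have key : ∑ g ∈ G, (Finset.univ.filter fun u => bad (g + t u)).card =
      Fintype.card U * (G.filter bad).card := by
    have h1 : ∀ u, (G.filter fun g => bad (g + t u)).card = (G.filter bad).card := by
      intro u
      refine Finset.card_bij (fun g _ => g + t u) ?_ ?_ ?_
      · intro g hg
        rw [Finset.mem_filter] at hg ⊢
        exact ⟨(hG g u).mp hg.1, hg.2⟩
      · intro a _ b _ hab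
        exact add_right_cancel hab
      · intro b hb
        rw [Finset.mem_filter] at hb
        refine ⟨b - t u, ?_, sub_add_cancel _ _⟩
        rw [Finset.mem_filter, hG _ u, sub_add_cancel]
        exact hb
    calc _ = ∑ u : U, (G.filter fun g => bad (g + t u)).card := by
          simp only [Finset.card_filter]
          exact Finset.sum_comm
      _ = _ := by simp [h1]
  have hU : (0 : ℝ) < Fintype.card U := by exact_mod_cast Fintype.card_pos
  have h2 : (Fintype.card U : ℝ) * (G.filter bad).card ≤ ∑ g ∈ G, ε * Fintype.card U := by
    rw [← Nat.cast_mul, ← key, Nat.cast_sum]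
    exact Finset.sum_le_sum h
  rw [Finset.sum_const, nsmul_eq_mul] at h2
  nlinarith

/-- The values of `x_j / x_i` at the points with `x_i ≠ 0` over which `W_{A,B}` is singular. -/
def singCoords (m : ℕ) (A B : MvPolynomial (Fin (m + 1)) F) (i j : Fin (m + 1)) :
    Set (AlgebraicClosure F) :=
  {τ | ∃ pt, SingAt F m A B pt ∧ pt i = 1 ∧ pt j = τ}

/-- The univariate polynomial with coefficient vector `c`. -/
def ofCoeffs {e : ℕ} (c : Fin (e + 1) → F) : Polynomial F :=
  ∑ s : Fin (e + 1), Polynomial.monomial (s : ℕ) (c s)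

/-- The homogenization in degree `e`, with respect to `x_i`, of `ofCoeffs F c` evaluated at
`x_j`. -/
def homogOfCoeffs {m e : ℕ} (i j : Fin (m + 1)) (c : Fin (e + 1) → F) :
    MvPolynomial (Fin (m + 1)) F :=
  ∑ s : Fin (e + 1), C (c s) * X j ^ (s : ℕ) * X i ^ (e - s)

/-- The form `∑ l, u_l ^ p * x_i ^ r * x_l` of degree `p * e + r + 1`, where the `u_l` are the
binary forms of degree `e` with the given coefficients. -/
def perturbation {m e : ℕ} (p r : ℕ) (i j : Fin (m + 1)) (c : Fin (m + 1) → Fin (e + 1) → F) :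
    MvPolynomial (Fin (m + 1)) F :=
  ∑ l, homogOfCoeffs F i j (c l) ^ p * X i ^ r * X l

theorem ofCoeffs_injective {e : ℕ} : Function.Injective (ofCoeffs F (e := e)) := by
  intro c c' h
  ext s
  have := congrArg (fun P => Polynomial.coeff P (s : ℕ)) h
  simpa [ofCoeffs, Polynomial.finsetSum_coeff, Polynomial.coeff_monomial, Fin.val_inj] using this

theorem perturbation_isHomogeneous {m e : ℕ} (p r : ℕ) (i j : Fin (m + 1))
    (c : Fin (m + 1) → Fin (e + 1) → F) :
    (perturbation F p r i j c).IsHomogeneous (p * e + r + 1) := by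
  refine IsHomogeneous.sum _ _ _ fun l _ => ?_
  refine IsHomogeneous.mul (IsHomogeneous.mul ?_ (isHomogeneous_X_pow i r)) (isHomogeneous_X F l)
  rw [mul_comm]
  refine IsHomogeneous.pow (IsHomogeneous.sum _ _ _ fun s _ => ?_) p
  have h := (isHomogeneous_C_mul_X_pow (c l s) j (s : ℕ)).mul
    (isHomogeneous_X_pow (R := F) i (e - s))
  rwa [Nat.add_sub_cancel' (Nat.lt_succ_iff.mp s.2)] at h

theorem aeval_homogOfCoeffs {m e : ℕ} (i j : Fin (m + 1)) (c : Fin (e + 1) → F)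
    (pt : Fin (m + 1) → AlgebraicClosure F) (hi : pt i = 1) :
    aeval pt (homogOfCoeffs F i j c) = Polynomial.aeval (pt j) (ofCoeffs F c) := by
  simp [homogOfCoeffs, ofCoeffs, hi, Polynomial.aeval_monomial]

theorem aeval_perturbation {m e : ℕ} (p r : ℕ) (i j : Fin (m + 1))
    (c : Fin (m + 1) → Fin (e + 1) → F)
    (pt : Fin (m + 1) → AlgebraicClosure F) (hi : pt i = 1) :
    aeval pt (perturbation F p r i j c) =
      ∑ l, Polynomial.aeval (pt j) (ofCoeffs F (c l)) ^ p * pt l := by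
  simp [perturbation, aeval_homogOfCoeffs F i j _ pt hi, hi]

theorem aeval_pderiv_perturbation {m e : ℕ} (p r : ℕ) [CharP F p] (i j : Fin (m + 1))
    (c : Fin (m + 1) → Fin (e + 1) → F)
    (pt : Fin (m + 1) → AlgebraicClosure F) (hi : pt i = 1) {l : Fin (m + 1)} (hl : l ≠ i) :
    aeval pt (pderiv l (perturbation F p r i j c)) =
      Polynomial.aeval (pt j) (ofCoeffs F (c l)) ^ p := by
  classical
  have hX : pderiv l (X i : MvPolynomial (Fin (m + 1)) F) = 0 := pderiv_X_of_ne hl.symm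
  have hp0 : (p : MvPolynomial (Fin (m + 1)) F) = 0 := by
    rw [← map_natCast (C : F →+* MvPolynomial (Fin (m + 1)) F), CharP.cast_eq_zero, map_zero]
  have h : pderiv l (perturbation F p r i j c) = homogOfCoeffs F i j (c l) ^ p * X i ^ r := by
    simp only [perturbation, map_sum, pderiv_mul, pderiv_pow, hX, hp0]
    rw [Finset.sum_eq_single l]
    · simp
    · intro b _ hb
      simp [pderiv_X_of_ne hb]
    · simp
  rw [h]
  simp [aeval_homogOfCoeffs F i j _ pt hi, hi]

theorem exists_relation_of_infinite_singCoords {m k p r e : ℕ} [CharP F p] (hp3 : 3 < p)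
    (hk : 1 ≤ k) {A B : MvPolynomial (Fin (m + 1)) F} (hA : A.IsHomogeneous (4 * k))
    (hB : B.IsHomogeneous (6 * k)) {i j : Fin (m + 1)} (hij : i ≠ j) :
    ∃ Ψ : MvPolynomial (Fin (m + 1)) (Polynomial F), Ψ ≠ 0 ∧
      (∀ l, Ψ.degreeOf l ≤ (2 * (m + 1) * (7 * k)) ^ (m + 1)) ∧
      ∀ c : Fin (m + 1) → Fin (e + 1) → F,
        (singCoords F m A (B + perturbation F p r i j c) i j).Infinite →
          eval (fun l => -(ofCoeffs F (c l)) ^ p) Ψ = 0 := by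
  classical
  let σ : MvPolynomial (Fin (m + 1)) F →ₐ[F] MvPolynomial (Fin (m + 1)) F :=
    aeval fun l => if l = i then 1 else X l
  have hσ : ∀ f, (σ f).totalDegree ≤ f.totalDegree :=
    totalDegree_aeval_le_of_totalDegree_le_one _ fun l => by split_ifs <;> simp
  have hσ' : ∀ {f : MvPolynomial (Fin (m + 1)) F} {n}, f.IsHomogeneous n →
      (σ f).totalDegree ≤ n := fun hf => (hσ _).trans hf.totalDegree_le
  let E' : Fin (m + 1) → MvPolynomial (Fin (m + 1)) F := fun l =>
    X i * σ (pderiv l A) + σ (pderiv l B)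
  let E : Fin (m + 1) → MvPolynomial (Fin (m + 1)) F := fun l => if l = i then
    σ B + σ A * X i + X i ^ 3 - ∑ l ∈ Finset.univ.erase i, X l * E' l else E' l
  have hE' : ∀ l, (E' l).totalDegree ≤ 6 * k := by
    intro l
    refine (totalDegree_add _ _).trans (max_le ((totalDegree_mul _ _).trans ?_) ?_)
    · have := hσ' (hA.pderiv (i := l))
      rw [totalDegree_X]
      omega
    · exact (hσ' hB.pderiv).trans (by omega)
  have hE : ∀ l, (E l).totalDegree ≤ 7 * k := by
    intro l
    simp only [E]
    split_ifs
    · refine (totalDegree_sub _ _).trans (max_le ((totalDegree_add _ _).trans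
        (max_le ((totalDegree_add _ _).trans (max_le ?_ ?_)) ?_)) ?_)
      · exact (hσ' hB).trans (by omega)
      · refine (totalDegree_mul _ _).trans ?_
        have := hσ' hA
        rw [totalDegree_X]
        omega
      · rw [totalDegree_X_pow]; omega
      · refine totalDegree_finsetSum_le fun l _ => (totalDegree_mul _ _).trans ?_
        have := hE' l
        rw [totalDegree_X]
        omega
    · exact (hE' l).trans (by omega)
  obtain ⟨Ψ, hΨ, hdeg, hrel⟩ := exists_relation_of_degreeOf_le (n := m + 1) (d := 7 * k)
    (by omega) (by omega) E (fun l i => (degreeOf_le_totalDegree _ _).trans (hE l)) j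
  refine ⟨Ψ, hΨ, hdeg, fun c hinf => ?_⟩
  by_contra h0
  refine hinf ((Polynomial.rootSet_finite (eval (fun l => -(ofCoeffs F (c l)) ^ p) Ψ)
    (AlgebraicClosure F)).subset ?_)
  rintro τ ⟨pt, ⟨x, y, hxy, hy, -, hd⟩, hpi, rfl⟩
  rw [Polynomial.mem_rootSet]
  refine ⟨h0, ?_⟩
  have h2 : (2 : AlgebraicClosure F) ≠ 0 := by
    have : CharP (AlgebraicClosure F) p := charP_of_injective_algebraMap
      (algebraMap F (AlgebraicClosure F)).injective p
    intro h
    have := (CharP.cast_eq_zero_iff (AlgebraicClosure F) p 2).mp (by exact_mod_cast h)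
    have := Nat.le_of_dvd (by norm_num) this
    omega
  have hy0 : y = 0 := (mul_eq_zero.mp hy).resolve_left h2
  let z : Fin (m + 1) → AlgebraicClosure F := Function.update pt i x
  have hzi : z i = x := by simp [z]
  have hzl : ∀ l, l ≠ i → z l = pt l := fun l hl => by simp [z, hl]
  have hzσ : ∀ f, aeval z (σ f) = aeval pt f := by
    intro f
    have : ((aeval z).comp σ : MvPolynomial (Fin (m + 1)) F →ₐ[F] AlgebraicClosure F) =
        aeval pt := by
      ext l
      by_cases hl : l = i
      · simp [σ, hl, hpi]
      · simp [σ, hl, hzl]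
    exact DFunLike.congr_fun this f
  have hzE' : ∀ l, l ≠ i → aeval z (E' l) = -Polynomial.aeval (pt j) (ofCoeffs F (c l)) ^ p := by
    intro l hl
    have h := hd l
    rw [map_add, map_add, aeval_pderiv_perturbation F p r i j c pt hpi hl] at h
    simp only [E', map_add, map_mul, hzσ, aeval_X, hzi]
    linear_combination h
  have hzE : ∀ l, aeval z (E l) = -Polynomial.aeval (pt j) (ofCoeffs F (c l)) ^ p := by
    intro l
    by_cases hl : l = i
    · subst hl
      simp only [E, if_true, map_add, map_sub, map_mul, map_pow, hzσ, aeval_X, hzi, map_sum]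
      rw [map_add, aeval_perturbation F p r l j c pt hpi, hy0,
        ← Finset.add_sum_erase _ _ (Finset.mem_univ l), hpi] at hxy
      have h3 : ∑ b ∈ Finset.univ.erase l, z b * aeval z (E' b) =
          -∑ b ∈ Finset.univ.erase l,
            Polynomial.aeval (pt j) (ofCoeffs F (c b)) ^ p * pt b := by
        rw [← Finset.sum_neg_distrib]
        refine Finset.sum_congr rfl fun b hb => ?_
        have hb := Finset.ne_of_mem_erase hb
        rw [hzE' b hb, hzl b hb]
        ring
      rw [h3]
      linear_combination -hxy
    · simp only [E, if_neg hl, hzE' l hl]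
  have h4 := congrArg (aeval z) hrel
  rw [map_zero] at h4
  rw [← h4]
  have h5 : ∀ P : MvPolynomial (Fin (m + 1)) (Polynomial F),
      Polynomial.aeval (pt j) (eval (fun l => -(ofCoeffs F (c l)) ^ p) P) =
      aeval z (eval₂ (Polynomial.aeval (X j : MvPolynomial (Fin (m + 1)) F)).toRingHom E P) := by
    intro P
    induction P using MvPolynomial.induction_on with
    | C a =>
      simp only [eval_C, eval₂_C, AlgHom.toRingHom_eq_coe, RingHom.coe_coe]
      rw [← Polynomial.aeval_algHom_apply, aeval_X, hzl j hij.symm]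
    | add P Q hP hQ => simp only [map_add, eval₂_add, hP, hQ]
    | mul_X P l hP =>
      simp only [map_mul, eval₂_mul, hP, eval_X, eval₂_X, hzE, map_neg, map_pow]
  exact h5 Ψ

theorem aeval_smul_of_isHomogeneous {m n : ℕ} {f : MvPolynomial (Fin (m + 1)) F}
    (hf : f.IsHomogeneous n) (a : AlgebraicClosure F) (pt : Fin (m + 1) → AlgebraicClosure F) :
    aeval (a • pt) f = a ^ n * aeval pt f := by
  rw [aeval_def, aeval_def, eval₂_eq', eval₂_eq', Finset.mul_sum]
  refine Finset.sum_congr rfl fun s hs => ?_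
  have h : ∑ i, s i = n := by
    rw [hf.degree_eq_sum_deg_support hs]
    exact (Finset.sum_subset (Finset.subset_univ _) fun i _ hi =>
      Finsupp.notMem_support_iff.mp hi).symm
  simp only [Pi.smul_apply, smul_eq_mul, mul_pow, Finset.prod_mul_distrib,
    Finset.prod_pow_eq_pow_sum, h]
  ring

theorem SingAt.smul {m k : ℕ} (hk : 1 ≤ k) {A B : MvPolynomial (Fin (m + 1)) F}
    (hA : A.IsHomogeneous (4 * k)) (hB : B.IsHomogeneous (6 * k))
    {pt : Fin (m + 1) → AlgebraicClosure F} (h : SingAt F m A B pt) (a : AlgebraicClosure F) :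
    SingAt F m A B (a • pt) := by
  obtain ⟨x, y, h1, h2, h3, h4⟩ := h
  refine ⟨a ^ (2 * k) * x, a ^ (3 * k) * y, ?_, ?_, ?_, fun i => ?_⟩
  · rw [aeval_smul_of_isHomogeneous F hA, aeval_smul_of_isHomogeneous F hB]
    linear_combination (a ^ (6 * k)) * h1
  · linear_combination (a ^ (3 * k)) * h2
  · rw [aeval_smul_of_isHomogeneous F hA]
    linear_combination (a ^ (4 * k)) * h3
  · rw [aeval_smul_of_isHomogeneous F hA.pderiv, aeval_smul_of_isHomogeneous F hB.pderiv]
    have h5 : a ^ (6 * k - 1) = a ^ (4 * k - 1) * a ^ (2 * k) := by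
      rw [← pow_add]; congr 1; omega
    rw [h5]
    linear_combination (a ^ (4 * k - 1) * a ^ (2 * k)) * h4 i

theorem finite_singOver_of_finite_singCoords {m k : ℕ} (hk : 1 ≤ k)
    {A B : MvPolynomial (Fin (m + 1)) F}
    (hA : A.IsHomogeneous (4 * k)) (hB : B.IsHomogeneous (6 * k))
    (h : ∀ i j, i ≠ j → (singCoords F m A B i j).Finite) :
    {P : Projectivization (AlgebraicClosure F) (Fin (m + 1) → AlgebraicClosure F) |
      SingOver F m A B P}.Finite := by
  have h' : ∀ i j, (singCoords F m A B i j).Finite := by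
    intro i j
    by_cases hij : i = j
    · subst hij
      refine (Set.finite_singleton 1).subset ?_
      rintro _ ⟨pt, -, hpt, rfl⟩
      exact hpt
    · exact h i j hij
  have hfin : (⋃ i, Set.univ.pi (singCoords F m A B i)).Finite :=
    Set.finite_iUnion fun i => Set.Finite.pi' (h' i) |>.subset fun f hf j => hf j trivial
  have hfin' : {v : {v : Fin (m + 1) → AlgebraicClosure F // v ≠ 0} |
      v.1 ∈ ⋃ i, Set.univ.pi (singCoords F m A B i)}.Finite :=
    hfin.preimage Subtype.val_injective.injOn
  refine (hfin'.image fun v => Projectivization.mk (AlgebraicClosure F) v.1 v.2).subset ?_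
  rintro P ⟨pt, hpt, rfl, hs⟩
  obtain ⟨i, hi⟩ := Function.ne_iff.mp hpt
  have hi : pt i ≠ 0 := hi
  have hne : (pt i)⁻¹ • pt ≠ 0 := smul_ne_zero (inv_ne_zero hi) hpt
  refine ⟨⟨(pt i)⁻¹ • pt, hne⟩, ?_, ?_⟩
  · refine Set.mem_iUnion.mpr ⟨i, fun j _ => ?_⟩
    exact ⟨_, hs.smul F hk hA hB (pt i)⁻¹, by simp [hi], rfl⟩
  · rw [Projectivization.mk_eq_mk_iff']
    exact ⟨(pt i)⁻¹, rfl⟩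

theorem finite_WPairs (m k : ℕ) : (WPairs F m k).Finite := by
  have h : ∀ n, {f : MvPolynomial (Fin (m + 1)) F | f.IsHomogeneous n}.Finite := by
    intro n
    have : Finite (restrictTotalDegree (Fin (m + 1)) F n) := Module.finite_of_finite F
    refine (Set.toFinite (restrictTotalDegree (Fin (m + 1)) F n : Set _)).subset fun f hf => ?_
    exact (mem_restrictTotalDegree _ _ _).mpr (IsHomogeneous.totalDegree_le hf)
  exact ((h (4 * k)).prod (h (6 * k))).subset fun AB hAB => hAB

theorem card_eval_eq_zero_le {p : ℕ} [CharP F p] (hp : p.Prime) {n e D : ℕ}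
    {Ψ : MvPolynomial (Fin n) (Polynomial F)} (hΨ : Ψ ≠ 0) (hdeg : ∀ l, Ψ.degreeOf l ≤ D)
    (bad : (Fin n → Fin (e + 1) → F) → Prop) [DecidablePred bad]
    (hbad : ∀ c, bad c → eval (fun l => -(ofCoeffs F (c l)) ^ p) Ψ = 0) :
    ((Finset.univ.filter bad).card : ℝ) ≤
      n * D / Fintype.card F ^ (e + 1) * Fintype.card (Fin n → Fin (e + 1) → F) := by
  classical
  have : Fact p.Prime := ⟨hp⟩
  let φ : (Fin (e + 1) → F) → Polynomial F := fun c => -(ofCoeffs F c) ^ p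
  have hφ : Function.Injective φ := fun c c' h =>
    ofCoeffs_injective F (frobenius_inj (Polynomial F) p (neg_injective h))
  let S : Finset (Polynomial F) := Finset.univ.image φ
  have hS : S.card = Fintype.card F ^ (e + 1) := by
    rw [Finset.card_image_of_injective _ hφ]
    simp
  have h1 : (Finset.univ.filter bad).card ≤
      ((Fintype.piFinset fun _ : Fin n => S).filter fun f => eval f Ψ = 0).card := by
    refine Finset.card_le_card_of_injOn (fun c l => φ (c l)) ?_ ?_
    · intro c hc
      simp only [Finset.coe_filter, Finset.mem_univ, true_and, Set.mem_ofPred_eq] at hc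
      simp only [Finset.coe_filter, Set.mem_ofPred_eq, Fintype.mem_piFinset]
      exact ⟨fun l => Finset.mem_image_of_mem _ (Finset.mem_univ _), hbad c hc⟩
    · intro c _ c' _ h
      funext l
      exact hφ (congrFun h l)
  have h2 := schwartz_zippel_sum_degreeOf hΨ fun _ => S
  rw [Finset.prod_const, Finset.card_univ, Fintype.card_fin, hS] at h2
  have h3 : (∑ l, (Ψ.degreeOf l : ℚ≥0) / ((Fintype.card F ^ (e + 1) : ℕ) : ℚ≥0)) ≤
      n * D / ((Fintype.card F ^ (e + 1) : ℕ) : ℚ≥0) := by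
    calc _ ≤ ∑ l : Fin n, (D : ℚ≥0) / ((Fintype.card F ^ (e + 1) : ℕ) : ℚ≥0) := by
          gcongr with l
          exact_mod_cast hdeg l
      _ = _ := by simp [mul_div_assoc]
  have hq : (0 : ℚ≥0) < ((Fintype.card F ^ (e + 1) : ℕ) : ℚ≥0) := by
    exact_mod_cast pow_pos Fintype.card_pos _
  have h4 := (div_le_iff₀ (pow_pos hq n)).mp (h2.trans h3)
  have h5 : ((((Fintype.piFinset fun _ : Fin n => S).filter fun f => eval f Ψ = 0).card : ℕ) : ℝ) ≤
      n * D / ((Fintype.card F ^ (e + 1) : ℕ) : ℝ) * ((Fintype.card F ^ (e + 1) : ℕ) : ℝ) ^ n := by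
    have h6 := (NNRat.cast_le (K := ℝ)).mpr h4
    push_cast at h6 ⊢
    exact h6
  refine (Nat.cast_le.mpr h1).trans (h5.trans_eq ?_)
  simp

/-- The pairs with infinitely many values of `x_j / x_i` on the singular locus are rare. -/
theorem card_infinite_singCoords_le {p : ℕ} [CharP F p] (hp : p.Prime) (hp3 : 3 < p) {m k : ℕ}
    (hk : 1 ≤ k) {i j : Fin (m + 1)} (hij : i ≠ j)
    [DecidablePred fun AB : MvPolynomial (Fin (m + 1)) F × MvPolynomial (Fin (m + 1)) F =>
      (singCoords F m AB.1 AB.2 i j).Infinite] :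
    (((finite_WPairs F m k).toFinset.filter fun AB =>
        (singCoords F m AB.1 AB.2 i j).Infinite).card : ℝ) ≤
      (m + 1 : ℕ) * ((2 * (m + 1) * (7 * k)) ^ (m + 1) : ℕ) /
        Fintype.card F ^ ((6 * k - 1) / p + 1) * (finite_WPairs F m k).toFinset.card := by
  classical
  set e := (6 * k - 1) / p with he
  have hdiv : p * e + (6 * k - 1) % p + 1 = 6 * k := by
    rw [he, Nat.div_add_mod]
    omega
  have hpert : ∀ c : Fin (m + 1) → Fin (e + 1) → F,
      (perturbation F p ((6 * k - 1) % p) i j c).IsHomogeneous (6 * k) := fun c => by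
    have := perturbation_isHomogeneous F p ((6 * k - 1) % p) i j c
    rwa [hdiv] at this
  refine card_filter_le_of_translates (U := Fin (m + 1) → Fin (e + 1) → F) _
    (fun c => (0, perturbation F p ((6 * k - 1) % p) i j c)) ?_ _ _ ?_
  · rintro ⟨A, B⟩ c
    simp only [Set.Finite.mem_toFinset, WPairs, Set.mem_ofPred_eq, Prod.mk_add_mk, add_zero]
    refine and_congr_right fun _ => ⟨fun h => h.add (hpert c), fun h => ?_⟩
    simpa using h.sub (hpert c)
  · rintro ⟨A, B⟩ hAB
    rw [Set.Finite.mem_toFinset] at hAB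
    obtain ⟨Ψ, hΨ, hdeg, hrel⟩ := exists_relation_of_infinite_singCoords F
      (r := (6 * k - 1) % p) (e := e) hp3 hk hAB.1 hAB.2 hij
    refine card_eval_eq_zero_le F hp hΨ hdeg _ fun c hc => hrel c ?_
    simpa using hc

theorem one_sub_le_card_div_card {p : ℕ} [CharP F p] (hp : p.Prime) (hp3 : 3 < p) {m k : ℕ}
    (hk : 1 ≤ k) :
    1 - (m + 1 : ℕ) ^ 3 * ((2 * (m + 1) * (7 * k)) ^ (m + 1) : ℕ) /
        (Fintype.card F : ℝ) ^ ((6 * k - 1) / p + 1) ≤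
      (Nat.card {AB ∈ WPairs F m k |
            {P : Projectivization (AlgebraicClosure F) (Fin (m + 1) → AlgebraicClosure F) |
              SingOver F m AB.1 AB.2 P}.Finite} : ℝ) /
          (Nat.card (WPairs F m k) : ℝ) := by
  classical
  set G := (finite_WPairs F m k).toFinset with hG
  set good : MvPolynomial (Fin (m + 1)) F × MvPolynomial (Fin (m + 1)) F → Prop := fun AB =>
    {P : Projectivization (AlgebraicClosure F) (Fin (m + 1) → AlgebraicClosure F) |
              SingOver F m AB.1 AB.2 P}.Finite with hgood
  have h1 : Nat.card (WPairs F m k) = G.card := Nat.card_eq_card_finite_toFinset _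
  have h2 : Nat.card {AB ∈ WPairs F m k | good AB} = (G.filter good).card := by
    rw [← Nat.card_eq_finsetCard]
    refine Nat.card_congr (Equiv.setCongr ?_)
    ext AB
    simp [hG]
  have hpos : (0 : ℝ) < G.card := by
    refine Nat.cast_pos.mpr (Finset.card_pos.mpr ⟨(0, 0), ?_⟩)
    simp [hG, WPairs, isHomogeneous_zero]
  have h3 := Finset.card_filter_add_card_filter_not (s := G) good
  set ε : ℝ := (m + 1 : ℕ) * ((2 * (m + 1) * (7 * k)) ^ (m + 1) : ℕ) /
        Fintype.card F ^ ((6 * k - 1) / p + 1) with hε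
  have hε0 : 0 ≤ ε := by positivity
  have h4 : ((G.filter fun AB => ¬ good AB).card : ℝ) ≤ (m + 1 : ℕ) ^ 2 * (ε * G.card) := by
    let bad : Fin (m + 1) × Fin (m + 1) →
        Finset (MvPolynomial (Fin (m + 1)) F × MvPolynomial (Fin (m + 1)) F) := fun ij =>
      if ij.1 = ij.2 then ∅ else G.filter fun AB => (singCoords F m AB.1 AB.2 ij.1 ij.2).Infinite
    have hsub : (G.filter fun AB => ¬ good AB) ⊆ Finset.univ.biUnion bad := by
      intro AB hAB
      rw [Finset.mem_filter] at hAB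
      have hW := (Set.Finite.mem_toFinset _).mp hAB.1
      by_contra hno
      refine hAB.2 (finite_singOver_of_finite_singCoords F hk hW.1 hW.2 fun i j hij => ?_)
      by_contra hinf
      refine hno (Finset.mem_biUnion.mpr ⟨(i, j), Finset.mem_univ _, ?_⟩)
      simp only [bad, if_neg hij, Finset.mem_filter]
      exact ⟨hAB.1, hinf⟩
    have hcard : ((Finset.univ.biUnion bad).card : ℝ) ≤ ∑ ij, ((bad ij).card : ℝ) := by
      exact_mod_cast Finset.card_biUnion_le
    calc _ ≤ ((Finset.univ.biUnion bad).card : ℝ) := by exact_mod_cast Finset.card_le_card hsub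
      _ ≤ ∑ ij : Fin (m + 1) × Fin (m + 1), ε * G.card := by
        refine hcard.trans (Finset.sum_le_sum fun ij _ => ?_)
        by_cases hij : ij.1 = ij.2
        · simp only [bad, if_pos hij, Finset.card_empty, Nat.cast_zero]
          positivity
        · simp only [bad, if_neg hij]
          exact card_infinite_singCoords_le F hp hp3 hk hij
      _ = _ := by simp [sq]
  rw [h1, h2, le_div_iff₀ hpos]
  have h5 : ((G.filter good).card : ℝ) + (G.filter fun AB => ¬ good AB).card = G.card := by
    exact_mod_cast h3
  have h6 : ((m + 1 : ℕ) : ℝ) ^ 3 * ((2 * (m + 1) * (7 * k)) ^ (m + 1) : ℕ) /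
        (Fintype.card F : ℝ) ^ ((6 * k - 1) / p + 1) = (m + 1 : ℕ) ^ 2 * ε := by
    rw [hε]; ring
  rw [h6]
  linarith

/-- for `m ≥ 3` the fraction of Weierstrass pairs of level `k` whose
set of singular points in `ℙ^m(𝔽̄_q)` is finite (i.e. whose model is smooth in
codimension 3) tends to `1` as `k → ∞`. -/
theorem stmt13 (p : ℕ) (hp : p.Prime) (hp3 : 3 < p) [CharP F p] (m : ℕ) (hm : 3 ≤ m) :
    Tendsto (fun k : ℕ =>
        (Nat.card {AB ∈ WPairs F m k |
            {P : Projectivization (AlgebraicClosure F) (Fin (m + 1) → AlgebraicClosure F) |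
              SingOver F m AB.1 AB.2 P}.Finite} : ℝ) /
          (Nat.card (WPairs F m k) : ℝ))
      atTop (nhds 1) := by
  set ρ : ℝ := (2 : ℝ) ^ (1 / (p : ℝ)) with hρ
  have hp0 : (0 : ℝ) < p := by exact_mod_cast hp.pos
  have hρ1 : 1 < ρ := Real.one_lt_rpow (by norm_num) (by positivity)
  have hρp : ρ ^ p = 2 := by
    rw [hρ, ← Real.rpow_natCast, ← Real.rpow_mul (by norm_num), one_div,
      inv_mul_cancel₀ hp0.ne', Real.rpow_one]
  set K : ℝ := (m + 1 : ℕ) ^ 3 * (14 * (m + 1 : ℕ)) ^ (m + 1) with hK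
  have hlim : Tendsto (fun k : ℕ => 1 - K * ((k : ℝ) ^ (m + 1) / ρ ^ k)) atTop (nhds 1) := by
    simpa using ((tendsto_pow_const_div_const_pow_of_one_lt (m + 1) hρ1).const_mul K).const_sub 1
  refine tendsto_of_tendsto_of_tendsto_of_le_of_le' hlim tendsto_const_nhds ?_ ?_
  · filter_upwards [eventually_ge_atTop 1] with k hk
    refine le_trans ?_ (one_sub_le_card_div_card F hp hp3 hk)
    have hpow : ρ ^ k ≤ (Fintype.card F : ℝ) ^ ((6 * k - 1) / p + 1) := by
      have h1 : k ≤ p * ((6 * k - 1) / p + 1) := by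
        have := Nat.lt_mul_div_succ (6 * k - 1) hp.pos
        omega
      calc ρ ^ k ≤ ρ ^ (p * ((6 * k - 1) / p + 1)) := pow_le_pow_right₀ hρ1.le h1
        _ = 2 ^ ((6 * k - 1) / p + 1) := by rw [pow_mul, hρp]
        _ ≤ _ := by
          gcongr
          exact_mod_cast Fintype.one_lt_card (α := F)
    have hnum : ((m + 1 : ℕ) : ℝ) ^ 3 * ((2 * (m + 1) * (7 * k)) ^ (m + 1) : ℕ) =
        K * (k : ℝ) ^ (m + 1) := by
      have h2 : 2 * (m + 1) * (7 * k) = 14 * (m + 1) * k := by ring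
      rw [hK, h2, mul_pow _ k]
      push_cast
      ring
    rw [hnum, ← mul_div_assoc]
    gcongr
  · refine Eventually.of_forall fun k => div_le_one_of_le₀ ?_ (Nat.cast_nonneg _)
    have := finite_WPairs F m k
    exact_mod_cast Nat.card_mono this (Set.sep_subset _ _)
end
end
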